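/- Let (ιₖ, pₖ)_{k∈ℤ} be an admissible sequence and define, for each i ∈ I, θᵢ := min{k ∈ ℤ≥1 : ιₖ = i} and ξᵢ := p_{θᵢ}. Suppose i, j ∈ I satisfy i ∼ j, dᵢ = 1, and dⱼ = ord(σ) > 1, where ord(σ) denotes the order of the automorphism σ. Then there exists a unique element j° in the σ-orbit of j such that |ξᵢ − ξ_{j°}| = 1 and ξ_{σᵏ(j°)} = ξ_{j°} + 2k for all 0 ≤ k < ord(σ) (this is condition (ii) in the definition of a height function on (Δ,σ)). -/

import Mathlib

open Set

variable {I : Type*} [Fintype I]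

/-- The cardinality `dᵢ` of the `⟨σ⟩`-orbit of `i`. -/
noncomputable def orbSize (σ : Equiv.Perm I) (i : I) : ℕ :=
  Nat.card {j : I | ∃ k : ℤ, (σ ^ k) i = j}

/-- `s⁺ = min {t | s < t, ι t = ι s}`. -/
noncomputable def splus (ιs : ℤ → I) (s : ℤ) : ℤ := sInf {t : ℤ | s < t ∧ ιs t = ιs s}

/-- `s⁻ = max {t | t < s, ι t = ι s}`. -/
noncomputable def sminus (ιs : ℤ → I) (s : ℤ) : ℤ := sSup {t : ℤ | t < s ∧ ιs t = ιs s}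

/-- An admissible sequence `(ιₖ, pₖ)_{k ∈ ℤ}` in `I × ℤ`, with respect to a finite simple
graph `Δ` on `I` and an automorphism `σ` of `Δ`. -/
structure IsAdmissibleSeq (Δ : SimpleGraph I) (σ : Equiv.Perm I)
    (ιs : ℤ → I) (p : ℤ → ℤ) : Prop where
  /-- `σ` is an automorphism of `Δ`. -/
  adj_iff : ∀ i j : I, Δ.Adj (σ i) (σ j) ↔ Δ.Adj i j
  /-- each fiber of `ιs` is unbounded above -/
  unbdd_above : ∀ (i : I) (n : ℤ), ∃ k, n < k ∧ ιs k = i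
  /-- each fiber of `ιs` is unbounded below -/
  unbdd_below : ∀ (i : I) (n : ℤ), ∃ k, k < n ∧ ιs k = i
  /-- (a) `p_{s⁺} = pₛ + 2 d_{ιₛ}` -/
  ha : ∀ s : ℤ, p (splus ιs s) = p s + 2 * (orbSize σ (ιs s) : ℤ)
  /-- (b) `pₜ = pₛ + min(d_{ιₛ}, d_{ιₜ})` whenever `ιₛ ∼ ιₜ` and `t⁻ < s < t < s⁺` -/
  hb : ∀ s t : ℤ, Δ.Adj (ιs s) (ιs t) → sminus ιs t < s → s < t → t < splus ιs s →
        p t = p s + min (orbSize σ (ιs s) : ℤ) (orbSize σ (ιs t) : ℤ)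
  /-- (c) `pₜ − (pₛ + 2) ∈ 2 d_{ιₛ} ℤ` whenever `ιₜ = σ(ιₛ)` -/
  hc : ∀ s t : ℤ, ιs t = σ (ιs s) → (2 * (orbSize σ (ιs s) : ℤ)) ∣ (p t - (p s + 2))

/-- `θᵢ = min {k ∈ ℤ≥1 | ιₖ = i}`. -/
noncomputable def theta (ιs : ℤ → I) (i : I) : ℤ := sInf {k : ℤ | 1 ≤ k ∧ ιs k = i}

/-- `ξᵢ = p_{θᵢ}`, the height function attached to the admissible sequence. -/
noncomputable def xi (ιs : ℤ → I) (p : ℤ → ℤ) (i : I) : ℤ := p (theta ιs i)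

omit [Fintype I] in
theorem isLeast_splus {ιs : ℤ → I} (habove : ∀ (i : I) (n : ℤ), ∃ k, n < k ∧ ιs k = i) (s : ℤ) :
    IsLeast {t : ℤ | s < t ∧ ιs t = ιs s} (splus ιs s) := by
  have hb : BddBelow {t : ℤ | s < t ∧ ιs t = ιs s} := ⟨s, fun _ ht => ht.1.le⟩
  exact ⟨Int.csInf_mem (habove (ιs s) s) hb, fun t ht => csInf_le hb ht⟩

omit [Fintype I] in
theorem isGreatest_sminus {ιs : ℤ → I} (hbelow : ∀ (i : I) (n : ℤ), ∃ k, k < n ∧ ιs k = i)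
    (s : ℤ) : IsGreatest {t : ℤ | t < s ∧ ιs t = ιs s} (sminus ιs s) := by
  have hb : BddAbove {t : ℤ | t < s ∧ ιs t = ιs s} := ⟨s, fun _ ht => ht.1.le⟩
  exact ⟨Int.csSup_mem (hbelow (ιs s) s) hb, fun t ht => le_csSup hb ht⟩

omit [Fintype I] in
theorem isLeast_theta {ιs : ℤ → I} (habove : ∀ (i : I) (n : ℤ), ∃ k, n < k ∧ ιs k = i) (i : I) :
    IsLeast {k : ℤ | 1 ≤ k ∧ ιs k = i} (theta ιs i) := by
  have hb : BddBelow {k : ℤ | 1 ≤ k ∧ ιs k = i} := ⟨1, fun _ ht => ht.1⟩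
  obtain ⟨k, hk, hki⟩ := habove i 0
  exact ⟨Int.csInf_mem ⟨k, hk, hki⟩ hb, fun t ht => csInf_le hb ht⟩

omit [Fintype I] in
theorem exists_first_after {ιs : ℤ → I} (habove : ∀ (i : I) (n : ℤ), ∃ k, n < k ∧ ιs k = i)
    (c : I) (x : ℤ) : ∃ t, IsLeast {t : ℤ | x < t ∧ ιs t = c} t := by
  have hb : BddBelow {t : ℤ | x < t ∧ ιs t = c} := ⟨x, fun _ ht => ht.1.le⟩
  exact ⟨_, Int.csInf_mem (habove c x) hb, fun t ht => csInf_le hb ht⟩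

omit [Fintype I] in
theorem exists_last_before {ιs : ℤ → I} (hbelow : ∀ (i : I) (n : ℤ), ∃ k, k < n ∧ ιs k = i)
    (c : I) (x : ℤ) : ∃ t, IsGreatest {t : ℤ | t < x ∧ ιs t = c} t := by
  have hb : BddAbove {t : ℤ | t < x ∧ ιs t = c} := ⟨x, fun _ ht => ht.1.le⟩
  exact ⟨_, Int.csSup_mem (hbelow c x) hb, fun t ht => le_csSup hb ht⟩

omit [Fintype I] in
theorem orbSize_zpow_apply (σ : Equiv.Perm I) (j : I) (m : ℤ) :
    orbSize σ ((σ ^ m) j) = orbSize σ j := by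
  have hset : {x : I | ∃ k : ℤ, (σ ^ k) ((σ ^ m) j) = x} = {x : I | ∃ k : ℤ, (σ ^ k) j = x} := by
    ext x
    constructor
    · rintro ⟨k, hk⟩
      exact ⟨k + m, by rw [zpow_add, Equiv.Perm.mul_apply, hk]⟩
    · rintro ⟨k, hk⟩
      exact ⟨k - m, by rw [← Equiv.Perm.mul_apply, ← zpow_add, sub_add_cancel, hk]⟩
  unfold orbSize
  rw [hset]

omit [Fintype I] in
theorem apply_eq_self_of_orbSize_eq_one {σ : Equiv.Perm I} {i : I} (hi : orbSize σ i = 1) :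
    σ i = i := by
  have := (Nat.card_eq_one_iff_unique.mp hi).1
  have heq := this.elim (⟨σ i, 1, by simp⟩ : {x : I | ∃ k : ℤ, (σ ^ k) i = x}) ⟨i, 0, by simp⟩
  exact congrArg Subtype.val heq

namespace IsAdmissibleSeq

variable {Δ : SimpleGraph I} {σ : Equiv.Perm I} {ιs : ℤ → I} {p : ℤ → ℤ}

omit [Fintype I] in
theorem splus_sminus (h : IsAdmissibleSeq Δ σ ιs p) (s : ℤ) : splus ιs (sminus ιs s) = s := by
  have hm := isGreatest_sminus h.unbdd_below s
  have hp := isLeast_splus h.unbdd_above (sminus ιs s)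
  apply le_antisymm (hp.2 ⟨hm.1.1, hm.1.2.symm⟩)
  by_contra! hlt
  exact absurd (hm.2 ⟨hlt, hp.1.2.trans hm.1.2⟩) (not_le.mpr hp.1.1)

omit [Fintype I] in
theorem sminus_splus (h : IsAdmissibleSeq Δ σ ιs p) (s : ℤ) : sminus ιs (splus ιs s) = s := by
  have hp := isLeast_splus h.unbdd_above s
  have hm := isGreatest_sminus h.unbdd_below (splus ιs s)
  apply le_antisymm _ (hm.2 ⟨hp.1.1, hp.1.2.symm⟩)
  by_contra! hlt
  exact absurd (hp.2 ⟨hlt, hm.1.2.trans hp.1.2⟩) (not_le.mpr hm.1.1)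

omit [Fintype I] in
theorem eq_sminus_add (h : IsAdmissibleSeq Δ σ ιs p) (s : ℤ) :
    p s = p (sminus ιs s) + 2 * (orbSize σ (ιs s) : ℤ) := by
  have := h.ha (sminus ιs s)
  rwa [h.splus_sminus, (isGreatest_sminus h.unbdd_below s).1.2] at this

omit [Fintype I] in
theorem exists_eq_add_of_le (h : IsAdmissibleSeq Δ σ ιs p) {a b : ℤ} (hab : a ≤ b)
    (hι : ιs a = ιs b) : ∃ n : ℕ, p b = p a + 2 * (orbSize σ (ιs a) : ℤ) * n := by
  induction hk : (b - a).toNat using Nat.strong_induction_on generalizing b with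
  | _ k ih =>
    rcases hab.eq_or_lt with rfl | hlt
    · exact ⟨0, by simp⟩
    · have hm := isGreatest_sminus h.unbdd_below b
      have hle : a ≤ sminus ιs b := hm.2 ⟨hlt, hι⟩
      have hmb : sminus ιs b < b := hm.1.1
      obtain ⟨n, hn⟩ := ih _ (by omega) hle (hι.trans hm.1.2.symm) rfl
      refine ⟨n + 1, ?_⟩
      rw [h.eq_sminus_add b, hn, ← hι]
      push_cast
      ring

omit [Fintype I] in
theorem le_of_le (h : IsAdmissibleSeq Δ σ ιs p) {a b : ℤ} (hab : a ≤ b)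
    (hι : ιs a = ιs b) : p a ≤ p b := by
  obtain ⟨n, hn⟩ := h.exists_eq_add_of_le hab hι
  have : (0 : ℤ) ≤ 2 * (orbSize σ (ιs a) : ℤ) * n := by positivity
  omega

omit [Fintype I] in
/-- Between two consecutive occurrences of `i` the value of `p` at a neighbour of `i` is forced. -/
theorem eq_add_one_of_between (h : IsAdmissibleSeq Δ σ ιs p) {s t : ℤ}
    (hadj : Δ.Adj (ιs s) (ιs t)) (hs : orbSize σ (ιs s) = 1) (ht : 1 ≤ orbSize σ (ιs t))
    (hst : s < t) (hts : t < splus ιs s) : p t = p s + 1 := by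
  have hp := isLeast_splus h.unbdd_above s
  have hmin : min (orbSize σ (ιs s) : ℤ) (orbSize σ (ιs t) : ℤ) = 1 := by
    rw [hs]; simpa using ht
  obtain ⟨t₁, ⟨hst₁, ht₁⟩, hl₁⟩ := exists_first_after h.unbdd_above (ιs t) s
  obtain ⟨t₂, ⟨hts₂, ht₂⟩, hl₂⟩ := exists_last_before h.unbdd_below (ιs t) (splus ιs s)
  have h1t : t₁ ≤ t := hl₁ ⟨hst, rfl⟩
  have ht2 : t ≤ t₂ := hl₂ ⟨hts, rfl⟩
  have hm₁ := isGreatest_sminus h.unbdd_below t₁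
  have hp₂ := isLeast_splus h.unbdd_above t₂
  have hne := hadj.ne
  have e₁ : p t₁ = p s + 1 := by
    have := h.hb s t₁ (by rwa [ht₁]) ?_ hst₁ (by omega)
    · rwa [ht₁, hmin] at this
    · by_contra! hle
      rcases hle.eq_or_lt with heq | hlt
      · exact hne (by rw [heq, hm₁.1.2, ht₁])
      · exact absurd (hl₁ ⟨hlt, hm₁.1.2.trans ht₁⟩) (not_le.mpr hm₁.1.1)
  have e₂ : p (splus ιs s) = p t₂ + 1 := by
    have := h.hb t₂ (splus ιs s) (by rw [ht₂, hp.1.2]; exact hadj.symm)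
      (by rw [h.sminus_splus]; omega) hts₂ ?_
    · rwa [ht₂, hp.1.2, min_comm, hmin] at this
    · by_contra! hle
      rcases hle.eq_or_lt with heq | hlt
      · exact hne (by rw [← hp.1.2, ← heq, hp₂.1.2, ht₂])
      · exact absurd (hl₂ ⟨hlt, hp₂.1.2.trans ht₂⟩) (not_le.mpr hp₂.1.1)
  have e₃ := h.ha s
  have l₁ := h.le_of_le h1t ht₁
  have l₂ := h.le_of_le ht2 ht₂.symm
  rw [hs] at e₃
  push_cast at e₃
  omega

omit [Fintype I] in
theorem exists_xi_eq (h : IsAdmissibleSeq Δ σ ιs p) {i j : I} (hadj : Δ.Adj i j)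
    (hi : orbSize σ i = 1) (hj : 1 ≤ orbSize σ j) :
    ∃ n : ℤ, 0 ≤ n ∧ n ≤ orbSize σ j ∧ xi ιs p j = xi ιs p i - 1 + 2 * n := by
  obtain ⟨⟨hi1, hi2⟩, hil⟩ := isLeast_theta h.unbdd_above i
  obtain ⟨⟨hj1, hj2⟩, hjl⟩ := isLeast_theta h.unbdd_above j
  unfold xi
  set a := theta ιs i
  set t := theta ιs j
  have key : ∀ t', ιs t' = j → ∃ s, s < t' ∧ t' < splus ιs s ∧ ιs s = i ∧ p t' = p s + 1 ∧
      (∀ b, b < t' → ιs b = i → b ≤ s) := by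
    intro t' ht'
    obtain ⟨s, ⟨hst, hs⟩, hl⟩ := exists_last_before h.unbdd_below i t'
    have hp := isLeast_splus h.unbdd_above s
    have hlt : t' < splus ιs s := by
      by_contra! hle
      rcases hle.eq_or_lt with heq | hlt
      · exact hadj.ne (by rw [← hs, ← hp.1.2, heq, ht'])
      · exact absurd (hl ⟨hlt, hp.1.2.trans hs⟩) (not_le.mpr hp.1.1)
    exact ⟨s, hst, hlt, hs, h.eq_add_one_of_between (by rwa [hs, ht']) (by rwa [hs])
      (by rwa [ht']) hst hlt, fun b hb hbi => hl ⟨hb, hbi⟩⟩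
  have hma := isGreatest_sminus h.unbdd_below a
  have hmt := isGreatest_sminus h.unbdd_below t
  have ha0 : sminus ιs a < 1 := by
    by_contra! hle
    exact absurd (hil ⟨hle, hma.1.2.trans hi2⟩) (not_le.mpr hma.1.1)
  have ht0 : sminus ιs t < 1 := by
    by_contra! hle
    exact absurd (hjl ⟨hle, hmt.1.2.trans hj2⟩) (not_le.mpr hmt.1.1)
  obtain ⟨s, -, -, hs, hps, hsl⟩ := key t hj2
  obtain ⟨s', hs't, -, hs', hps', -⟩ := key _ (hmt.1.2.trans hj2)
  have hpa := h.eq_sminus_add a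
  have hpt := h.eq_sminus_add t
  rw [hi2, hi] at hpa
  rw [hj2] at hpt
  obtain ⟨n, hn⟩ := h.exists_eq_add_of_le (hsl _ (by omega) (hma.1.2.trans hi2))
    (hma.1.2.trans (hi2.trans hs.symm))
  have hs'a : s' ≤ sminus ιs a := hma.2 ⟨by omega, hs'.trans hi2.symm⟩
  have hle := h.le_of_le hs'a (hs'.trans (hma.1.2.trans hi2).symm)
  rw [hma.1.2, hi2, hi] at hn
  push_cast at hpa hn
  exact ⟨n, by omega, by omega, by omega⟩

end IsAdmissibleSeq

theorem stmt17 (Δ : SimpleGraph I) (σ : Equiv.Perm I) (ιs : ℤ → I) (p : ℤ → ℤ)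
    (h : IsAdmissibleSeq Δ σ ιs p) (i j : I) (hadj : Δ.Adj i j)
    (hdi : orbSize σ i = 1) (hdj : orbSize σ j = orderOf σ) (hord : 1 < orderOf σ) :
    ∃! j0 : I, (∃ m : ℤ, (σ ^ m) j = j0) ∧ |xi ιs p i - xi ιs p j0| = 1 ∧
      ∀ k : ℕ, k < orderOf σ → xi ιs p ((σ ^ k) j0) = xi ιs p j0 + 2 * (k : ℤ) := by
  have hσi := apply_eq_self_of_orbSize_eq_one hdi
  have hstep : ∀ x, Δ.Adj i (σ x) ↔ Δ.Adj i x := fun x => by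
    simpa [hσi] using h.adj_iff i x
  have hadjm : ∀ m : ℤ, Δ.Adj i ((σ ^ m) j) := by
    intro m
    induction m using Int.induction_on with
    | zero => simpa using hadj
    | succ n ih =>
      rw [add_comm, zpow_one_add, Equiv.Perm.mul_apply, hstep]
      exact ih
    | pred n ih =>
      rw [← hstep, ← Equiv.Perm.mul_apply, ← zpow_one_add]
      rwa [add_sub_cancel]
  have hd : ∀ m : ℤ, orbSize σ ((σ ^ m) j) = orderOf σ := fun m => by
    rw [orbSize_zpow_apply, hdj]
  have hex : ∀ m : ℤ, ∃ n : ℤ, 0 ≤ n ∧ n ≤ orderOf σ ∧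
      xi ιs p ((σ ^ m) j) = xi ιs p i - 1 + 2 * n := fun m => by
    have := h.exists_xi_eq (hadjm m) hdi (by rw [hd]; exact hord.le)
    rwa [hd] at this
  choose f hf0 hfd hf using hex
  have hfs : ∀ m : ℤ, (orderOf σ : ℤ) ∣ f (m + 1) - f m - 1 := by
    intro m
    have h1 := (isLeast_theta h.unbdd_above ((σ ^ m) j)).1.2
    have h2 := (isLeast_theta h.unbdd_above ((σ ^ (m + 1)) j)).1.2
    have hc := h.hc _ _ (h2.trans (by rw [h1, add_comm, zpow_one_add, Equiv.Perm.mul_apply]))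
    rw [h1, hd] at hc
    change _ ∣ xi ιs p _ - (xi ιs p _ + 2) at hc
    rw [hf, hf] at hc
    rw [show xi ιs p i - 1 + 2 * f (m + 1) - (xi ιs p i - 1 + 2 * f m + 2) =
      2 * (f (m + 1) - f m - 1) by ring] at hc
    exact (mul_dvd_mul_iff_left two_ne_zero).mp hc
  have hfm : ∀ m : ℤ, (orderOf σ : ℤ) ∣ f m - f 0 - m := by
    intro m
    induction m using Int.induction_on with
    | zero => simp
    | succ n ih =>
      have := dvd_add ih (hfs n)
      rwa [show f n - f 0 - n + (f (n + 1) - f n - 1) = f (n + 1) - f 0 - (n + 1) by ring] at this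
    | pred n ih =>
      have := dvd_sub ih (hfs (-n - 1))
      rw [sub_add_cancel] at this
      rwa [show f (-n) - f 0 - -n - (f (-n) - f (-n - 1) - 1) = f (-n - 1) - f 0 - (-n - 1) by
        ring] at this
  have hper : ∀ m : ℤ, (σ ^ (m + orderOf σ)) j = (σ ^ m) j := fun m => by
    rw [zpow_add, zpow_natCast, pow_orderOf_eq_one, mul_one]
  have hfper : ∀ m : ℤ, f (m + orderOf σ) = f m := fun m => by
    have := hf (m + orderOf σ)
    rw [hper, hf] at this
    omega
  have hmul : ∀ (m : ℤ) (k : ℕ), (σ ^ k) ((σ ^ m) j) = (σ ^ (m + k)) j := fun m k => by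
    rw [← zpow_natCast, ← Equiv.Perm.mul_apply, ← zpow_add, add_comm]
  set d := orderOf σ with hdef
  have hval : ∀ (m : ℤ) (r : ℤ), f 0 + m = r → 0 < r → r < d → f m = r := by
    intro m r hr h0 h1
    obtain ⟨c, hc⟩ := hfm m
    have h2 := hf0 m
    have h3 := hfd m
    have : c = 0 := by
      have h4 : (d : ℤ) * c < d * 1 := by omega
      have h5 : (d : ℤ) * (-1) < d * c := by omega
      have hdpos : (0 : ℤ) < d := by omega
      have := lt_of_mul_lt_mul_left h4 hdpos.le
      have := lt_of_mul_lt_mul_left h5 hdpos.le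
      omega
    subst this
    omega
  have hone : ∀ m : ℤ, |xi ιs p i - xi ιs p ((σ ^ m) j)| = 1 ↔ f m = 0 ∨ f m = 1 := by
    intro m
    rw [hf, abs_eq zero_le_one]
    omega
  have hend : f (-f 0) = 0 ∨ f (-f 0) = d := by
    obtain ⟨c, hc⟩ := hfm (-f 0)
    have h2 := hf0 (-f 0)
    have h3 := hfd (-f 0)
    have hdpos : (0 : ℤ) < d := by omega
    have h4 : (d : ℤ) * c ≤ d * 1 := by omega
    have h5 : (d : ℤ) * 0 ≤ d * c := by omega
    have := le_of_mul_le_mul_left h4 hdpos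
    have := le_of_mul_le_mul_left h5 hdpos
    obtain rfl | rfl : c = 0 ∨ c = 1 := by omega
    · left; omega
    · right; omega
  have hexm : ∃ m : ℤ, (f m = 0 ∨ f m = 1) ∧ ∀ k : ℕ, k < d → f (m + k) = f m + k := by
    rcases hend with he | he
    · refine ⟨-f 0, .inl he, fun k hk => ?_⟩
      rcases Nat.eq_zero_or_pos k with rfl | hk0
      · simp
      · rw [hval _ k (by ring) (by omega) (by omega), he, zero_add]
    · have h1 : f (-f 0 + 1) = 1 := hval _ 1 (by ring) (by omega) (by omega)
      refine ⟨-f 0 + 1, .inr h1, fun k hk => ?_⟩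
      rw [h1]
      rcases eq_or_ne (k + 1) d with hkd | hkd
      · rw [show -f 0 + 1 + (k : ℤ) = -f 0 + d by omega, hfper, he]
        omega
      · exact hval _ _ (by ring) (by omega) (by omega)
  obtain ⟨m, hm1, hm2⟩ := hexm
  refine ⟨(σ ^ m) j, ⟨⟨m, rfl⟩, (hone m).mpr hm1, fun k hk => ?_⟩, ?_⟩
  · rw [hmul, hf, hf, hm2 k hk]
    ring
  rintro _ ⟨⟨m', rfl⟩, habs, hk'⟩
  have hm1' := (hone m').mp habs
  have hm2' : ∀ k : ℕ, k < d → f (m' + k) = f m' + k := fun k hk => by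
    have := hk' k hk
    rw [hmul, hf, hf] at this
    omega
  have hdpos : (0 : ℤ) < d := by omega
  have hshift : ∃ k : ℕ, k < d ∧ (σ ^ m') j = (σ ^ (m + k)) j := by
    refine ⟨((m' - m) % d).toNat, ?_, ?_⟩
    · have := Int.emod_lt_of_pos (m' - m) hdpos
      omega
    · rw [Int.toNat_of_nonneg (Int.emod_nonneg _ hdpos.ne'), zpow_add, zpow_mod_orderOf,
        ← zpow_add, add_sub_cancel]
  obtain ⟨k, hkd, hk⟩ := hshift
  have hfeq : f m' = f (m + k) := by
    have h1 := hf m'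
    rw [hk, hf] at h1
    omega
  rw [hm2 k hkd] at hfeq
  obtain rfl | rfl : k = 0 ∨ k = 1 := by omega
  · simpa using hk
  · exfalso
    have h1 := hm2' (d - 1) (by omega)
    have h2 : (σ ^ (m' + ((d - 1 : ℕ) : ℤ))) j = (σ ^ m) j := by
      rw [← hmul, hk, hmul, ← hper m]
      congr 2
      push_cast [hord.le]
      ring
    have h3 := hf (m' + ((d - 1 : ℕ) : ℤ))
    rw [h2, hf] at h3
    omega
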